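/- Let A = {A_n} and B = {B_n} be sequences of sets with A_n convex compact permutation-invariant sets of quantum states on H^{⊗n}, B_n convex compact permutation-invariant sets of positive semidefinite operators on H^{⊗n}, both sequences stable under tensor product, both with polar sets stable under tensor product, and with D_max(A_n‖B_n) ≤ cn for all n and some constant c ≥ 0. Then for any r > D^∞(A‖B), the type-I error converges to one exponentially fast: liminf_{n→∞} −(1/n) log (1 − α_{n,r}(A_n‖B_n)) ≥ sup_{α>1} ((α−1)/α)(r − D_{S,α}^∞(A‖B)) > 0, where D_{S,α}^∞(A‖B) := lim_{n→∞} (1/n) inf_{ρ∈A_n, σ∈B_n} D_{S,α}(ρ‖σ). -/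

import Mathlib

open Filter Set
open scoped ComplexOrder Classical

noncomputable section

/-- The index type of the `n`-fold tensor power of a `d`-dimensional Hilbert space. -/
abbrev TIdx (d n : ℕ) := Fin n → Fin d

/-- Operators on the `n`-fold tensor power of a `d`-dimensional complex Hilbert space. -/
abbrev Mat (d n : ℕ) := Matrix (TIdx d n) (TIdx d n) ℂ

/-- A quantum state: positive semidefinite with unit trace. -/
def IsState {d n : ℕ} (ρ : Mat d n) : Prop := ρ.PosSemidef ∧ ρ.trace = 1

/-- Tensor product of an operator on `H^{⊗m}` and one on `H^{⊗n}`, as an operator on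
`H^{⊗(m+n)}`. -/
def tensorProd {d m n : ℕ} (A : Mat d m) (B : Mat d n) : Mat d (m + n) :=
  Matrix.of fun f g =>
    A (fun i => f (Fin.castAdd n i)) (fun i => g (Fin.castAdd n i)) *
      B (fun j => f (Fin.natAdd m j)) (fun j => g (Fin.natAdd m j))

/-- `suppLE ρ σ` means the support of `ρ` is contained in the support of `σ`
(equivalently, `ker σ ⊆ ker ρ` for Hermitian PSD matrices). -/
def suppLE {d n : ℕ} (ρ σ : Mat d n) : Prop :=
  ∀ v : TIdx d n → ℂ, σ.mulVec v = 0 → ρ.mulVec v = 0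

/-- Real matrix power via the functional calculus (junk value `0` for non-Hermitian input);
powers are taken on the support since `(0:ℝ) ^ p = 0` for `p ≠ 0`. -/
def mpow {d n : ℕ} (A : Mat d n) (p : ℝ) : Mat d n :=
  if h : A.IsHermitian then
    (h.eigenvectorUnitary : Mat d n) *
      Matrix.diagonal (fun i => ((h.eigenvalues i ^ p : ℝ) : ℂ)) *
      (star (h.eigenvectorUnitary : Mat d n))
  else 0

/-- Matrix base-2 logarithm via the functional calculus, taken on the support. -/
def mlog {d n : ℕ} (A : Mat d n) : Mat d n :=
  if h : A.IsHermitian then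
    (h.eigenvectorUnitary : Mat d n) *
      Matrix.diagonal (fun i => ((Real.logb 2 (h.eigenvalues i) : ℝ) : ℂ)) *
      (star (h.eigenvectorUnitary : Mat d n))
  else 0

/-- The Petz quasi-divergence quantity `tr[ρ^α σ^{1-α}]`. -/
def qPetz {d n : ℕ} (α : ℝ) (ρ σ : Mat d n) : ℝ :=
  (mpow ρ α * mpow σ (1 - α)).trace.re

/-- The Petz Rényi divergence (base-2), `+∞` unless `supp ρ ⊆ supp σ`. -/
def DPetz {d n : ℕ} (α : ℝ) (ρ σ : Mat d n) : EReal :=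
  if suppLE ρ σ then (((α - 1)⁻¹ * Real.logb 2 (qPetz α ρ σ) : ℝ) : EReal) else ⊤

/-- The sandwiched quasi-divergence quantity `tr[(σ^{(1-α)/(2α)} ρ σ^{(1-α)/(2α)})^α]`. -/
def qSand {d n : ℕ} (α : ℝ) (ρ σ : Mat d n) : ℝ :=
  (mpow (mpow σ ((1 - α) / (2 * α)) * ρ * mpow σ ((1 - α) / (2 * α))) α).trace.re

/-- The sandwiched Rényi divergence (base-2), `+∞` unless `supp ρ ⊆ supp σ`. -/
def DSand {d n : ℕ} (α : ℝ) (ρ σ : Mat d n) : EReal :=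
  if suppLE ρ σ then (((α - 1)⁻¹ * Real.logb 2 (qSand α ρ σ) : ℝ) : EReal) else ⊤

/-- The quantum Hoeffding divergence `H_{n,r}(ρ‖σ)`. -/
def Hoeffding {d : ℕ} (n : ℕ) (r : ℝ) (ρ σ : Mat d n) : EReal :=
  ⨆ α ∈ Set.Ioo (0 : ℝ) 1,
    (((α - 1) / α : ℝ) : EReal) * ((((n : ℝ) * r : ℝ) : EReal) - DPetz α ρ σ)

/-- The quantum Hoeffding anti-divergence `H*_{n,r}(ρ‖σ)`. -/
def HoeffdingA {d : ℕ} (n : ℕ) (r : ℝ) (ρ σ : Mat d n) : EReal :=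
  ⨆ α ∈ Set.Ioi (1 : ℝ),
    (((α - 1) / α : ℝ) : EReal) * ((((n : ℝ) * r : ℝ) : EReal) - DSand α ρ σ)

/-- Petz Rényi divergence between two sets of states. -/
def DPetzSet {d n : ℕ} (α : ℝ) (A B : Set (Mat d n)) : EReal :=
  ⨅ ρ ∈ A, ⨅ σ ∈ B, DPetz α ρ σ

/-- Sandwiched Rényi divergence between two sets of states. -/
def DSandSet {d n : ℕ} (α : ℝ) (A B : Set (Mat d n)) : EReal :=
  ⨅ ρ ∈ A, ⨅ σ ∈ B, DSand α ρ σ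

/-- Quantum Hoeffding divergence between two sets of states. -/
def HoeffdingSet {d : ℕ} (n : ℕ) (r : ℝ) (A B : Set (Mat d n)) : EReal :=
  ⨅ ρ ∈ A, ⨅ σ ∈ B, Hoeffding n r ρ σ

/-- Quantum Hoeffding anti-divergence between two sets of states. -/
def HoeffdingASet {d : ℕ} (n : ℕ) (r : ℝ) (A B : Set (Mat d n)) : EReal :=
  ⨆ ρ ∈ A, ⨆ σ ∈ B, HoeffdingA n r ρ σ

/-- A test (two-outcome POVM element): `0 ≤ M ≤ I`. -/
def IsTest {d n : ℕ} (M : Mat d n) : Prop := M.PosSemidef ∧ (1 - M).PosSemidef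

/-- Worst-case type-I error of a test `M` for the set `A`. -/
def typeI {d n : ℕ} (A : Set (Mat d n)) (M : Mat d n) : ℝ :=
  ⨆ ρ ∈ A, (ρ * (1 - M)).trace.re

/-- Worst-case type-II error of a test `M` for the set `B`. -/
def typeII {d n : ℕ} (B : Set (Mat d n)) (M : Mat d n) : ℝ :=
  ⨆ σ ∈ B, (σ * M).trace.re

/-- Optimal type-I error at type-II error exponent `r`:
`α_{n,r}(A‖B) = inf { α(A,M) : 0 ≤ M ≤ I, β(B,M) ≤ 2^{-nr} }`. -/
def optAlpha {d : ℕ} (n : ℕ) (r : ℝ) (A B : Set (Mat d n)) : ℝ :=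
  sInf {x | ∃ M : Mat d n, IsTest M ∧ typeII B M ≤ (2 : ℝ) ^ (-((n : ℝ) * r)) ∧ x = typeI A M}

/-- Optimal type-I error for a single pair of states. -/
def optAlphaPair {d : ℕ} (n : ℕ) (r : ℝ) (ρ σ : Mat d n) : ℝ :=
  optAlpha n r {ρ} {σ}

/-- `- log₂ x` as an extended real, with `-log₂ 0 = +∞`. -/
def negLog2 (x : ℝ) : EReal := if x = 0 then ⊤ else ((-Real.logb 2 x : ℝ) : EReal)

/-- A sequence of sets of operators is stable under tensor product. -/
def Stable {d : ℕ} (A : ∀ n : ℕ, Set (Mat d n)) : Prop :=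
  ∀ m n : ℕ, ∀ X ∈ A m, ∀ Y ∈ A n, tensorProd X Y ∈ A (m + n)

/-- Invariance under conjugation by the unitaries permuting the tensor factors. -/
def PermInvariant {d n : ℕ} (C : Set (Mat d n)) : Prop :=
  ∀ π : Equiv.Perm (Fin n), ∀ M ∈ C,
    Matrix.of (fun f g : TIdx d n => M (f ∘ π) (g ∘ π)) ∈ C

/-- The polar of a set of positive semidefinite operators. -/
def polar {d n : ℕ} (C : Set (Mat d n)) : Set (Mat d n) :=
  {X | X.PosSemidef ∧ ∀ Y ∈ C, (X * Y).trace.re ≤ 1}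

/-- Max-relative entropy between two sets (base-2):
`inf_{ρ∈A,σ∈B} log inf {λ ≥ 0 : ρ ≤ λσ}`. -/
def DmaxSet {d n : ℕ} (A B : Set (Mat d n)) : EReal :=
  ⨅ ρ ∈ A, ⨅ σ ∈ B, ⨅ lam ∈ {l : ℝ | 0 ≤ l ∧ (l • σ - ρ).PosSemidef},
    ((Real.logb 2 lam : ℝ) : EReal)

/-- Umegaki relative entropy (base-2), `+∞` unless `supp ρ ⊆ supp σ`. -/
def DUm {d n : ℕ} (ρ σ : Mat d n) : EReal :=
  if suppLE ρ σ then (((ρ * (mlog ρ - mlog σ)).trace.re : ℝ) : EReal) else ⊤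

/-- Umegaki relative entropy between two sets. -/
def DUmSet {d n : ℕ} (A B : Set (Mat d n)) : EReal :=
  ⨅ ρ ∈ A, ⨅ σ ∈ B, DUm ρ σ

/-- Spectral projection onto the nonnegative eigenspace of a matrix
(junk value `0` for non-Hermitian input). -/
def posProj {d n : ℕ} (X : Mat d n) : Mat d n :=
  if h : X.IsHermitian then
    (h.eigenvectorUnitary : Mat d n) *
      Matrix.diagonal (fun i => if 0 ≤ h.eigenvalues i then (1 : ℂ) else 0) *
      (star (h.eigenvectorUnitary : Mat d n))
  else 0

open Matrix

section MatrixAnalysis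

variable {ι : Type*} [Fintype ι] [DecidableEq ι]

lemma continuousOn_spectrum_real (f : ℝ → ℝ) (A : Matrix ι ι ℂ) :
    ContinuousOn f (spectrum ℝ A) :=
  Matrix.finite_real_spectrum.continuousOn f

lemma cfc_mul_cfc (f g : ℝ → ℝ) (A : Matrix ι ι ℂ) :
    cfc f A * cfc g A = cfc (fun x => f x * g x) A :=
  (cfc_mul f g A (continuousOn_spectrum_real f A) (continuousOn_spectrum_real g A)).symm

lemma isHermitian_cfc (f : ℝ → ℝ) (A : Matrix ι ι ℂ) : (cfc f A).IsHermitian :=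
  cfc_predicate f A

lemma cfc_cfc {A : Matrix ι ι ℂ} (hA : A.IsHermitian) (f g : ℝ → ℝ) :
    cfc g (cfc f A) = cfc (fun x => g (f x)) A :=
  (cfc_comp' g f A ((Matrix.finite_real_spectrum.image f).continuousOn g)
    (continuousOn_spectrum_real f A) hA).symm

lemma Matrix.PosSemidef.cfc_congr {A : Matrix ι ι ℂ} (hA : A.PosSemidef) {f g : ℝ → ℝ}
    (h : ∀ x, 0 ≤ x → f x = g x) : cfc f A = cfc g A := by
  refine _root_.cfc_congr fun x hx => ?_
  rw [hA.1.spectrum_real_eq_range_eigenvalues] at hx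
  obtain ⟨i, rfl⟩ := hx
  exact h _ (hA.eigenvalues_nonneg i)

lemma cfc_self {A : Matrix ι ι ℂ} (hA : A.IsHermitian) : cfc (fun x : ℝ => x) A = A :=
  cfc_id' ℝ A hA

lemma cfc_eq_conj {A : Matrix ι ι ℂ} (hA : A.IsHermitian) (f : ℝ → ℝ) :
    cfc f A = (hA.eigenvectorUnitary : Matrix ι ι ℂ) *
      diagonal (fun i => ((f (hA.eigenvalues i) : ℝ) : ℂ)) *
      (hA.eigenvectorUnitary : Matrix ι ι ℂ)ᴴ := by
  rw [hA.cfc_eq, Matrix.IsHermitian.cfc, Unitary.conjStarAlgAut_apply]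
  rfl

lemma eq_conj {A : Matrix ι ι ℂ} (hA : A.IsHermitian) :
    A = (hA.eigenvectorUnitary : Matrix ι ι ℂ) *
      diagonal (fun i => ((hA.eigenvalues i : ℝ) : ℂ)) *
      (hA.eigenvectorUnitary : Matrix ι ι ℂ)ᴴ := by
  conv_lhs => rw [← cfc_self hA]
  exact cfc_eq_conj hA _

lemma eigenvectorUnitary_conjTranspose_mul {A : Matrix ι ι ℂ} (hA : A.IsHermitian) :
    (hA.eigenvectorUnitary : Matrix ι ι ℂ)ᴴ * (hA.eigenvectorUnitary : Matrix ι ι ℂ) = 1 :=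
  Unitary.coe_star_mul_self hA.eigenvectorUnitary

lemma eigenvectorUnitary_mul_conjTranspose {A : Matrix ι ι ℂ} (hA : A.IsHermitian) :
    (hA.eigenvectorUnitary : Matrix ι ι ℂ) * (hA.eigenvectorUnitary : Matrix ι ι ℂ)ᴴ = 1 :=
  Unitary.coe_mul_star_self hA.eigenvectorUnitary

lemma trace_cfc {A : Matrix ι ι ℂ} (hA : A.IsHermitian) (f : ℝ → ℝ) :
    (cfc f A).trace.re = ∑ i, f (hA.eigenvalues i) := by
  rw [cfc_eq_conj hA, Matrix.trace_mul_cycle, eigenvectorUnitary_conjTranspose_mul, one_mul]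
  simp [Matrix.trace]

lemma trace_cfc_mul_conjTranspose (Y : Matrix ι ι ℂ) (f : ℝ → ℝ) :
    (cfc f (Y * Yᴴ)).trace.re = (cfc f (Yᴴ * Y)).trace.re := by
  have h1 := Matrix.isHermitian_mul_conjTranspose_self Y
  have h2 := Matrix.isHermitian_conjTranspose_mul_self Y
  have h := congrArg (fun s : Multiset ℂ => (s.map fun z => f z.re).sum)
    (congrArg Polynomial.roots (Matrix.charpoly_mul_comm Y Yᴴ))
  simp only [h1.roots_charpoly_eq_eigenvalues, h2.roots_charpoly_eq_eigenvalues,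
    Multiset.map_map] at h
  rw [trace_cfc h1, trace_cfc h2]
  simpa using h

lemma mul_diagonal_mul_conjTranspose_diag (P : Matrix ι ι ℂ) (a : ι → ℝ) (i : ι) :
    (P * diagonal (fun j => ((a j : ℝ) : ℂ)) * Pᴴ) i i =
      ((∑ j, a j * ‖P i j‖ ^ 2 : ℝ) : ℂ) := by
  rw [Matrix.mul_apply]
  push_cast
  refine Finset.sum_congr rfl fun j _ => ?_
  rw [Matrix.mul_diagonal, Matrix.conjTranspose_apply, ← Complex.mul_conj', starRingEnd_apply]
  ring

lemma sum_norm_sq_row (P : Matrix ι ι ℂ) (i : ι) :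
    ((∑ j, ‖P i j‖ ^ 2 : ℝ) : ℂ) = (P * Pᴴ) i i := by
  have := mul_diagonal_mul_conjTranspose_diag P (fun _ => 1) i
  simpa using this.symm

lemma trace_cfc_mul_cfc {A B : Matrix ι ι ℂ} (hA : A.IsHermitian) (hB : B.IsHermitian)
    (f g : ℝ → ℝ) :
    (cfc f A * cfc g B).trace.re = ∑ i, ∑ j, f (hA.eigenvalues i) * g (hB.eigenvalues j) *
      ‖((hA.eigenvectorUnitary : Matrix ι ι ℂ)ᴴ * (hB.eigenvectorUnitary : Matrix ι ι ℂ)) i j‖ ^ 2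
    := by
  set U := (hA.eigenvectorUnitary : Matrix ι ι ℂ)
  set V := (hB.eigenvectorUnitary : Matrix ι ι ℂ)
  have h : (cfc f A * cfc g B).trace =
      (diagonal (fun i => ((f (hA.eigenvalues i) : ℝ) : ℂ)) *
        ((Uᴴ * V) * diagonal (fun i => ((g (hB.eigenvalues i) : ℝ) : ℂ)) * (Uᴴ * V)ᴴ)).trace := by
    rw [cfc_eq_conj hA, cfc_eq_conj hB, mul_assoc, mul_assoc, Matrix.trace_mul_comm]
    simp only [conjTranspose_mul, conjTranspose_conjTranspose, mul_assoc]
    rfl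
  rw [h, Matrix.trace, Complex.re_sum]
  refine Finset.sum_congr rfl fun i _ => ?_
  rw [Matrix.diag_apply, Matrix.diagonal_mul, mul_diagonal_mul_conjTranspose_diag,
    ← Complex.ofReal_mul, Complex.ofReal_re, Finset.mul_sum]
  exact Finset.sum_congr rfl fun j _ => by ring

lemma sum_norm_sq_row_unitary {W : Matrix ι ι ℂ} (h : W * Wᴴ = 1) (i : ι) :
    ∑ j, ‖W i j‖ ^ 2 = 1 := by
  have := sum_norm_sq_row W i
  rw [h, Matrix.one_apply_eq] at this
  exact_mod_cast this

lemma sum_norm_sq_col_unitary {W : Matrix ι ι ℂ} (h : Wᴴ * W = 1) (j : ι) :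
    ∑ i, ‖W i j‖ ^ 2 = 1 := by
  have := sum_norm_sq_row_unitary (W := Wᴴ) (by rwa [conjTranspose_conjTranspose]) j
  simpa [conjTranspose_apply] using this

/-- Hölder's inequality for the trace of a product of positive semidefinite matrices. -/
lemma trace_mul_le_holder {A B : Matrix ι ι ℂ} (hA : A.PosSemidef) (hB : B.PosSemidef) {p q : ℝ}
    (hpq : p.HolderConjugate q) :
    (A * B).trace.re ≤ (cfc (fun x : ℝ => x ^ p) A).trace.re ^ (1 / p) *
      (cfc (fun x : ℝ => x ^ q) B).trace.re ^ (1 / q) := by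
  have key := trace_cfc_mul_cfc hA.1 hB.1 (fun x : ℝ => x) (fun x : ℝ => x)
  rw [cfc_self hA.1, cfc_self hB.1] at key
  rw [key, trace_cfc hA.1, trace_cfc hB.1]
  set W := (hA.1.eigenvectorUnitary : Matrix ι ι ℂ)ᴴ * (hB.1.eigenvectorUnitary : Matrix ι ι ℂ)
    with hW
  have hW1 : W * Wᴴ = 1 := by
    rw [hW, conjTranspose_mul, conjTranspose_conjTranspose,
      show ∀ U V : Matrix ι ι ℂ, Uᴴ * V * (Vᴴ * U) = Uᴴ * (V * Vᴴ) * U by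
        intro U V; simp only [mul_assoc],
      eigenvectorUnitary_mul_conjTranspose, mul_one, eigenvectorUnitary_conjTranspose_mul]
  have hW2 : Wᴴ * W = 1 := mul_eq_one_comm.mp hW1
  have ha := hA.eigenvalues_nonneg
  have hb := hB.eigenvalues_nonneg
  set a := hA.1.eigenvalues
  set b := hB.1.eigenvalues
  have hw : ∀ i j, 0 ≤ ‖W i j‖ ^ 2 := fun i j => by positivity
  have hp := hpq.pos
  have hq := hpq.symm.pos
  have H := Real.inner_le_Lp_mul_Lq_of_nonneg (Finset.univ : Finset (ι × ι)) hpq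
    (f := fun x => a x.1 * (‖W x.1 x.2‖ ^ 2) ^ (1 / p))
    (g := fun x => b x.2 * (‖W x.1 x.2‖ ^ 2) ^ (1 / q))
    (fun x _ => mul_nonneg (ha _) (Real.rpow_nonneg (hw _ _) _))
    (fun x _ => mul_nonneg (hb _) (Real.rpow_nonneg (hw _ _) _))
  have e0 : ∀ i j, a i * (‖W i j‖ ^ 2) ^ (1 / p) * (b j * (‖W i j‖ ^ 2) ^ (1 / q)) =
      a i * b j * ‖W i j‖ ^ 2 := by
    intro i j
    have : (‖W i j‖ ^ 2) ^ (1 / p) * (‖W i j‖ ^ 2) ^ (1 / q) = ‖W i j‖ ^ 2 := by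
      rw [← Real.rpow_add_of_nonneg (hw i j) (by positivity) (by positivity), one_div, one_div,
        hpq.inv_add_inv_eq_one, Real.rpow_one]
    linear_combination (a i * b j) * this
  have e1 : ∀ i j, (a i * (‖W i j‖ ^ 2) ^ (1 / p)) ^ p = a i ^ p * ‖W i j‖ ^ 2 := by
    intro i j
    rw [Real.mul_rpow (ha i) (Real.rpow_nonneg (hw i j) _), ← Real.rpow_mul (hw i j),
      one_div_mul_cancel hp.ne', Real.rpow_one]
  have e2 : ∀ i j, (b j * (‖W i j‖ ^ 2) ^ (1 / q)) ^ q = b j ^ q * ‖W i j‖ ^ 2 := by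
    intro i j
    rw [Real.mul_rpow (hb j) (Real.rpow_nonneg (hw i j) _), ← Real.rpow_mul (hw i j),
      one_div_mul_cancel hq.ne', Real.rpow_one]
  simp only [e0, e1, e2, Fintype.sum_prod_type] at H
  rw [Finset.sum_comm (f := fun i j => b j ^ q * ‖W i j‖ ^ 2)] at H
  simpa only [← Finset.mul_sum, sum_norm_sq_row_unitary hW1, sum_norm_sq_col_unitary hW2,
    mul_one] using H

/-- Jensen's trace inequality for the power function and the compression by a contraction. -/
lemma trace_cfc_rpow_compression_le {A S : Matrix ι ι ℂ} (hA : A.PosSemidef) (hS : S.IsHermitian)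
    (hS1 : (1 - S * S).PosSemidef) {p : ℝ} (hp : 1 ≤ p) :
    (cfc (fun x : ℝ => x ^ p) (S * A * S)).trace.re ≤
      (cfc (fun x : ℝ => x ^ p) A * (S * S)).trace.re := by
  have hB : (S * A * S).PosSemidef := by
    simpa [hS.eq] using hA.mul_mul_conjTranspose_same S
  have hU1 := eigenvectorUnitary_conjTranspose_mul hB.1
  have hlam := eq_conj hB.1
  rw [trace_cfc hB.1]
  set U := (hB.1.eigenvectorUnitary : Matrix ι ι ℂ)
  set V := (hA.1.eigenvectorUnitary : Matrix ι ι ℂ) with hV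
  set P := Uᴴ * S * V with hP
  have ha := hA.eigenvalues_nonneg
  have hPH : Pᴴ = Vᴴ * S * U := by
    simp [hP, conjTranspose_mul, hS.eq, mul_assoc]
  have conj : ∀ f : ℝ → ℝ, P * diagonal (fun j => ((f (hA.1.eigenvalues j) : ℝ) : ℂ)) * Pᴴ =
      Uᴴ * (S * cfc f A * S) * U := by
    intro f
    rw [cfc_eq_conj hA.1, hPH, hP]
    simp only [mul_assoc]
    rfl
  have hdiag : ∀ i, hB.1.eigenvalues i = ∑ j, hA.1.eigenvalues j * ‖P i j‖ ^ 2 := by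
    intro i
    have h1 := mul_diagonal_mul_conjTranspose_diag P hA.1.eigenvalues i
    rw [conj (fun x => x), cfc_self hA.1, hlam,
      show ∀ D, Uᴴ * (U * D * Uᴴ) * U = (Uᴴ * U) * D * (Uᴴ * U) by intro D; simp only [mul_assoc],
      hU1] at h1
    simpa only [one_mul, mul_one, diagonal_apply_eq, Complex.ofReal_inj] using h1
  have hle : ∀ i, ∑ j, ‖P i j‖ ^ 2 ≤ 1 := by
    intro i
    have h1 := (hS1.conjTranspose_mul_mul_same U).diag_nonneg (i := i)
    have h2 := sum_norm_sq_row P i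
    have h3 : P * Pᴴ = Uᴴ * (S * S) * U := by
      rw [hPH, hP, show Uᴴ * S * V * (Vᴴ * S * U) = Uᴴ * S * (V * Vᴴ) * S * U by
        simp only [mul_assoc], hV, eigenvectorUnitary_mul_conjTranspose]
      simp only [mul_assoc, mul_one]
    rw [mul_sub, sub_mul, mul_one, hU1, ← h3, Matrix.sub_apply, ← h2, one_apply_eq] at h1
    have h4 : (0 : ℂ) ≤ ((1 - ∑ j, ‖P i j‖ ^ 2 : ℝ) : ℂ) := by push_cast at h1 ⊢; exact h1
    rw [Complex.zero_le_real] at h4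
    linarith
  have hrhs : (cfc (fun x : ℝ => x ^ p) A * (S * S)).trace.re =
      ∑ i, ∑ j, hA.1.eigenvalues j ^ p * ‖P i j‖ ^ 2 := by
    have h1 : (cfc (fun x : ℝ => x ^ p) A * (S * S)).trace =
        (P * diagonal (fun j => ((hA.1.eigenvalues j ^ p : ℝ) : ℂ)) * Pᴴ).trace := by
      rw [conj (fun x => x ^ p), Matrix.trace_mul_cycle, mul_eq_one_comm.mp hU1, one_mul,
        ← mul_assoc, Matrix.trace_mul_comm, mul_assoc]
    rw [h1, Matrix.trace, Complex.re_sum]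
    refine Finset.sum_congr rfl fun i _ => ?_
    rw [diag_apply, mul_diagonal_mul_conjTranspose_diag P (fun j => hA.1.eigenvalues j ^ p),
      Complex.ofReal_re]
  rw [hrhs]
  refine Finset.sum_le_sum fun i _ => ?_
  have hp0 : 0 < p := by linarith
  have H := Real.inner_le_weight_mul_Lp_of_nonneg Finset.univ hp (fun j => ‖P i j‖ ^ 2)
    hA.1.eigenvalues (fun j => by positivity) ha
  have hs : 0 ≤ ∑ j, ‖P i j‖ ^ 2 := Finset.sum_nonneg fun j _ => by positivity
  have hT : 0 ≤ ∑ j, ‖P i j‖ ^ 2 * hA.1.eigenvalues j ^ p :=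
    Finset.sum_nonneg fun j _ => mul_nonneg (by positivity) (Real.rpow_nonneg (ha j) _)
  have h1 : (∑ j, ‖P i j‖ ^ 2) ^ (1 - p⁻¹) ≤ 1 :=
    Real.rpow_le_one hs (hle i) (sub_nonneg.2 (inv_le_one_of_one_le₀ hp))
  have h2 : hB.1.eigenvalues i ≤ (∑ j, ‖P i j‖ ^ 2 * hA.1.eigenvalues j ^ p) ^ p⁻¹ := by
    rw [hdiag i]
    simp only [mul_comm (hA.1.eigenvalues _)]
    exact H.trans (mul_le_of_le_one_left (Real.rpow_nonneg hT _) h1)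
  calc hB.1.eigenvalues i ^ p
      ≤ ((∑ j, ‖P i j‖ ^ 2 * hA.1.eigenvalues j ^ p) ^ p⁻¹) ^ p :=
        Real.rpow_le_rpow (hB.eigenvalues_nonneg i) h2 hp0.le
    _ = ∑ j, ‖P i j‖ ^ 2 * hA.1.eigenvalues j ^ p := by
        rw [← Real.rpow_mul hT, inv_mul_cancel₀ hp0.ne', Real.rpow_one]
    _ = ∑ j, hA.1.eigenvalues j ^ p * ‖P i j‖ ^ 2 :=
        Finset.sum_congr rfl fun j _ => mul_comm _ _

end MatrixAnalysis

section Sandwiched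

variable {ι : Type*} [Fintype ι] [DecidableEq ι]

/-- The sandwiched operator `σ^{(1-α)/(2α)} ρ σ^{(1-α)/(2α)}`. -/
def sandOp (α : ℝ) (ρ σ : Matrix ι ι ℂ) : Matrix ι ι ℂ :=
  cfc (fun x : ℝ => x ^ ((1 - α) / (2 * α))) σ * ρ * cfc (fun x : ℝ => x ^ ((1 - α) / (2 * α))) σ

/-- The sandwiched quasi-divergence for matrices over an arbitrary finite index type. -/
def sandQ (α : ℝ) (ρ σ : Matrix ι ι ℂ) : ℝ :=
  (cfc (fun x : ℝ => x ^ α) (sandOp α ρ σ)).trace.re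

lemma posSemidef_sandOp {ρ : Matrix ι ι ℂ} (hρ : ρ.PosSemidef) (α : ℝ) (σ : Matrix ι ι ℂ) :
    (sandOp α ρ σ).PosSemidef := by
  have := hρ.mul_mul_conjTranspose_same (cfc (fun x : ℝ => x ^ ((1 - α) / (2 * α))) σ)
  rwa [(isHermitian_cfc _ σ).eq] at this

lemma sandQ_nonneg {ρ : Matrix ι ι ℂ} (hρ : ρ.PosSemidef) (α : ℝ) (σ : Matrix ι ι ℂ) :
    0 ≤ sandQ α ρ σ := by
  rw [sandQ, trace_cfc (posSemidef_sandOp hρ α σ).1]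
  exact Finset.sum_nonneg fun i _ =>
    Real.rpow_nonneg ((posSemidef_sandOp hρ α σ).eigenvalues_nonneg i) _

/-- The projection onto the support of a Hermitian matrix. -/
def suppProj (σ : Matrix ι ι ℂ) : Matrix ι ι ℂ := cfc (fun x : ℝ => x⁻¹ * x) σ

lemma mul_suppProj {σ : Matrix ι ι ℂ} (hσ : σ.IsHermitian) : σ * suppProj σ = σ := by
  rw [suppProj]
  nth_rewrite 1 [← cfc_self hσ]
  rw [cfc_mul_cfc]
  conv_rhs => rw [← cfc_self hσ]
  congr 1
  funext x
  by_cases h : x = 0 <;> simp [h]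

lemma mul_suppProj_of_eq_mul {ρ σ K : Matrix ι ι ℂ} (hσ : σ.IsHermitian) (h : ρ = K * σ) :
    ρ * suppProj σ = ρ := by
  rw [h, mul_assoc, mul_suppProj hσ]

lemma suppProj_mul_of_eq_mul {ρ σ K : Matrix ι ι ℂ} (hρ : ρ.IsHermitian) (hσ : σ.IsHermitian)
    (h : ρ = K * σ) : suppProj σ * ρ = ρ := by
  have := congrArg conjTranspose (mul_suppProj_of_eq_mul hσ h)
  rwa [conjTranspose_mul, hρ.eq, suppProj, (isHermitian_cfc _ σ).eq] at this

lemma exists_eq_mul_iff {ρ σ : Matrix ι ι ℂ} (hσ : σ.IsHermitian) :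
    (∃ K, ρ = K * σ) ↔ ∀ v : ι → ℂ, σ.mulVec v = 0 → ρ.mulVec v = 0 := by
  constructor
  · rintro ⟨K, rfl⟩ v hv
    rw [← mulVec_mulVec, hv, mulVec_zero]
  · intro h
    have hfac : suppProj σ = cfc (fun x : ℝ => x⁻¹) σ * σ := by
      have h := cfc_mul_cfc (fun x : ℝ => x⁻¹) (fun x => x) σ
      rw [cfc_self hσ] at h
      exact h.symm
    refine ⟨ρ * cfc (fun x : ℝ => x⁻¹) σ, ?_⟩
    rw [mul_assoc, ← hfac, ← sub_eq_zero, ← mul_one ρ, mul_assoc, one_mul, ← mul_sub]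
    refine Matrix.ext_of_mulVec_single fun i => ?_
    rw [← mulVec_mulVec, zero_mulVec]
    refine h _ ?_
    rw [mulVec_mulVec, mul_sub, mul_one, mul_suppProj hσ, sub_self, zero_mulVec]

lemma cfc_rpow_mul_cfc_rpow_neg {σ : Matrix ι ι ℂ} (hσ : σ.PosSemidef) {s : ℝ} (hs : s ≠ 0) :
    cfc (fun x : ℝ => x ^ s) σ * cfc (fun x : ℝ => x ^ (-s)) σ = suppProj σ := by
  rw [cfc_mul_cfc, suppProj]
  refine hσ.cfc_congr fun x hx => ?_
  rcases hx.eq_or_lt with rfl | hx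
  · simp [Real.zero_rpow hs]
  · rw [← Real.rpow_add hx, inv_mul_cancel₀ hx.ne', add_neg_cancel, Real.rpow_zero]

/-- Monotonicity of the sandwiched quasi-divergence under a two-outcome measurement, in the form of
a bound on the probability of a single outcome. -/
lemma trace_mul_le_sandQ {ρ σ M K : Matrix ι ι ℂ} (hρ : ρ.PosSemidef) (hσ : σ.PosSemidef)
    (hK : ρ = K * σ) (hM : M.PosSemidef) (hM1 : (1 - M).PosSemidef) {α : ℝ} (hα : 1 < α) :
    (ρ * M).trace.re ≤
      sandQ α ρ σ ^ (1 / α) * (σ * M).trace.re ^ ((α - 1) / α) := by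
  have hα0 : 0 < α := by linarith
  have hpq : α.HolderConjugate (α / (α - 1)) := Real.HolderConjugate.conjExponent hα
  have hβ : 1 ≤ α / (α - 1) := hpq.symm.lt.le
  set s := (α - 1) / (2 * α) with hs
  have hs0 : s ≠ 0 := (div_pos (by linarith) (by linarith)).ne'
  have hneg : (1 - α) / (2 * α) = -s := by rw [hs]; ring
  set T := cfc (fun x : ℝ => x ^ s) σ with hT
  set S := cfc (fun x : ℝ => √x) M with hS
  have hTH : T.IsHermitian := isHermitian_cfc _ _
  have hSH : S.IsHermitian := isHermitian_cfc _ _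
  have hSS : S * S = M := by
    rw [hS, cfc_mul_cfc]
    conv_rhs => rw [← cfc_self hM.1]
    exact hM.cfc_congr fun x hx => Real.mul_self_sqrt hx
  have hTT : T * T = cfc (fun x : ℝ => x ^ ((α - 1) / α)) σ := by
    rw [hT, cfc_mul_cfc]
    refine hσ.cfc_congr fun x hx => ?_
    rcases hx.eq_or_lt with rfl | hx
    · rw [Real.zero_rpow hs0, Real.zero_rpow (div_pos (by linarith) hα0).ne', zero_mul]
    · rw [← Real.rpow_add hx]
      congr 1
      rw [hs]; field_simp; ring
  have hX : T * sandOp α ρ σ * T = ρ := by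
    rw [sandOp, hneg]
    have h1 := cfc_rpow_mul_cfc_rpow_neg hσ hs0
    have h2 := cfc_rpow_mul_cfc_rpow_neg hσ (neg_ne_zero.2 hs0)
    rw [neg_neg] at h2
    rw [show ∀ R : Matrix ι ι ℂ, T * (R * ρ * R) * T = (T * R) * ρ * (R * T) by
      intro R; simp only [mul_assoc], h1, h2, suppProj_mul_of_eq_mul hρ.1 hσ.1 hK,
      mul_suppProj_of_eq_mul hσ.1 hK]
  have hN : (T * M * T).PosSemidef := by
    have := hM.mul_mul_conjTranspose_same T
    rwa [hTH.eq] at this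
  have h1 : (ρ * M).trace = (sandOp α ρ σ * (T * M * T)).trace := by
    conv_lhs => rw [← hX]
    rw [show T * sandOp α ρ σ * T * M = T * (sandOp α ρ σ * (T * M)) by simp only [mul_assoc],
      Matrix.trace_mul_comm]
    simp only [mul_assoc]
  have h2 : (cfc (fun x : ℝ => x ^ (α / (α - 1))) (T * M * T)).trace.re ≤ (σ * M).trace.re := by
    have e1 : T * M * T = (T * S) * (T * S)ᴴ := by
      rw [conjTranspose_mul, hTH.eq, hSH.eq, ← hSS]; simp only [mul_assoc]
    have e2 : (T * S)ᴴ * (T * S) = S * cfc (fun x : ℝ => x ^ ((α - 1) / α)) σ * S := by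
      rw [conjTranspose_mul, hTH.eq, hSH.eq, ← hTT]; simp only [mul_assoc]
    have hTTp : (cfc (fun x : ℝ => x ^ ((α - 1) / α)) σ).PosSemidef := by
      rw [← hTT]
      have := Matrix.posSemidef_self_mul_conjTranspose T
      rwa [hTH.eq] at this
    rw [e1, trace_cfc_mul_conjTranspose, e2]
    refine (trace_cfc_rpow_compression_le hTTp hSH (by rwa [hSS]) hβ).trans_eq ?_
    rw [hSS, cfc_cfc hσ.1]
    congr 3
    conv_rhs => rw [← cfc_self hσ.1]
    refine hσ.cfc_congr fun x hx => ?_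
    rw [← Real.rpow_mul hx, div_mul_div_cancel₀ hα0.ne', div_self (by linarith), Real.rpow_one]
  have h3 : 0 ≤ (cfc (fun x : ℝ => x ^ (α / (α - 1))) (T * M * T)).trace.re := by
    rw [trace_cfc hN.1]
    exact Finset.sum_nonneg fun i _ => Real.rpow_nonneg (hN.eigenvalues_nonneg i) _
  rw [h1]
  refine (trace_mul_le_holder (posSemidef_sandOp hρ α σ) hN hpq).trans ?_
  rw [← sandQ, one_div_div]
  exact mul_le_mul_of_nonneg_left
    (Real.rpow_le_rpow h3 h2 (div_nonneg (by linarith) hα0.le))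
    (Real.rpow_nonneg (sandQ_nonneg hρ α σ) _)

end Sandwiched

section LimitAlphaToOne

open scoped Topology

variable {ι : Type*} [Fintype ι] [DecidableEq ι]

open scoped Matrix.Norms.L2Operator in
lemma tendsto_cfc_of_continuous {β : Type*} {l : Filter β} {X : β → Matrix ι ι ℂ}
    {A : Matrix ι ι ℂ} (hX : Tendsto X l (𝓝 A)) (hXH : ∀ᶠ x in l, (X x).IsHermitian)
    (hA : A.IsHermitian) {f : ℝ → ℝ} (hf : Continuous f) :
    Tendsto (fun x => cfc f (X x)) l (𝓝 (cfc f A)) := by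
  set C := (‖A‖ + 1) * ‖(1 : Matrix ι ι ℂ)‖
  have hsub : ∀ Y : Matrix ι ι ℂ, ‖Y‖ ≤ ‖A‖ + 1 → spectrum ℝ Y ⊆ Metric.closedBall 0 C := by
    intro Y hY k hk
    rw [mem_closedBall_zero_iff]
    exact (spectrum.norm_le_norm_mul_of_mem hk).trans
      (mul_le_mul_of_nonneg_right hY (norm_nonneg _))
  have hbound : ∀ᶠ x in l, ‖X x‖ ≤ ‖A‖ + 1 :=
    (hX.norm.eventually_lt_const (lt_add_one ‖A‖)).mono fun x hx => hx.le
  exact Filter.Tendsto.cfc (isCompact_closedBall (0 : ℝ) C) f hX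
    (hbound.mono fun x hx => hsub _ hx) hXH (hsub A (by linarith)) hA hf.continuousOn

lemma tendsto_cfc_of_pointwise {β : Type*} {l : Filter β} {A : Matrix ι ι ℂ} (hA : A.PosSemidef)
    {F : β → ℝ → ℝ} {f : ℝ → ℝ} (h : ∀ x, 0 ≤ x → Tendsto (fun b => F b x) l (𝓝 (f x))) :
    Tendsto (fun b => cfc (F b) A) l (𝓝 (cfc f A)) := by
  simp only [cfc_eq_conj hA.1]
  have hc : Continuous fun v : ι → ℂ => (hA.1.eigenvectorUnitary : Matrix ι ι ℂ) *
      diagonal v * (hA.1.eigenvectorUnitary : Matrix ι ι ℂ)ᴴ := by fun_prop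
  refine (hc.tendsto _).comp (tendsto_pi_nhds.2 fun i => ?_)
  exact (Complex.continuous_ofReal.tendsto _).comp (h _ (hA.eigenvalues_nonneg i))

lemma exists_trace_mul_cfc_eq_sum {ρ σ : Matrix ι ι ℂ} (hρ : ρ.IsHermitian)
    (hσ : σ.IsHermitian) :
    ∃ w : ι → ℝ, ∀ g : ℝ → ℝ, (ρ * cfc g σ).trace.re = ∑ j, w j * g (hσ.eigenvalues j) := by
  refine ⟨fun j => ∑ i, hρ.eigenvalues i *
    ‖((hρ.eigenvectorUnitary : Matrix ι ι ℂ)ᴴ * (hσ.eigenvectorUnitary : Matrix ι ι ℂ)) i j‖ ^ 2,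
    fun g => ?_⟩
  have h := trace_cfc_mul_cfc hρ hσ (fun x : ℝ => x) g
  rw [cfc_self hρ] at h
  rw [h, Finset.sum_comm]
  refine Finset.sum_congr rfl fun j _ => ?_
  rw [Finset.sum_mul]
  exact Finset.sum_congr rfl fun i _ => by ring

lemma tendsto_zero_exponent :
    Tendsto (fun t : ℝ => (1 - (1 + t)) / (2 * (1 + t))) (𝓝[>] 0) (𝓝 0) := by
  have h : ContinuousAt (fun t : ℝ => (1 - (1 + t)) / (2 * (1 + t))) 0 :=
    ContinuousAt.div (by fun_prop) (by fun_prop) (by norm_num)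
  have h1 := h.tendsto
  norm_num at h1
  exact (h1.mono_left nhdsWithin_le_nhds).congr fun t => by norm_num

lemma tendsto_sandOp {ρ σ K : Matrix ι ι ℂ} (hρ : ρ.IsHermitian) (hσ : σ.PosSemidef)
    (hK : ρ = K * σ) : Tendsto (fun t : ℝ => sandOp (1 + t) ρ σ) (𝓝[>] 0) (𝓝 ρ) := by
  have h : Tendsto (fun t : ℝ => cfc (fun x : ℝ => x ^ ((1 - (1 + t)) / (2 * (1 + t)))) σ)
      (𝓝[>] 0) (𝓝 (suppProj σ)) := by
    refine tendsto_cfc_of_pointwise hσ fun x hx => ?_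
    rcases hx.eq_or_lt with rfl | hx
    · refine tendsto_const_nhds.congr' ?_
      filter_upwards [self_mem_nhdsWithin] with t (ht : 0 < t)
      rw [mul_zero, Real.zero_rpow (div_ne_zero (by linarith) (by linarith))]
    · have := (tendsto_const_nhds (x := x)).rpow tendsto_zero_exponent (Or.inl hx.ne')
      rw [inv_mul_cancel₀ hx.ne']
      rwa [Real.rpow_zero] at this
  have := (h.mul_const ρ).mul h
  rwa [suppProj_mul_of_eq_mul hρ hσ.1 hK, mul_suppProj_of_eq_mul hσ.1 hK] at this

lemma tendsto_slope_rpow_mul_rpow {x : ℝ} (hx : 0 < x) :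
    Tendsto (fun t : ℝ => t⁻¹ * (x ^ ((1 - (1 + t)) / (2 * (1 + t))) *
      x ^ ((1 - (1 + t)) / (2 * (1 + t))) - 1)) (𝓝[>] 0) (𝓝 (-Real.log x)) := by
  have h1 : HasDerivAt (fun t : ℝ => (1 - (1 + t)) / (2 * (1 + t))) (-1 / 2) 0 := by
    have hn : HasDerivAt (fun t : ℝ => 1 - (1 + t)) (-1) 0 := by
      simpa using ((hasDerivAt_id (0 : ℝ)).const_add 1).const_sub 1
    have hd : HasDerivAt (fun t : ℝ => 2 * (1 + t)) 2 0 := by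
      simpa using ((hasDerivAt_id (0 : ℝ)).const_add 1).const_mul 2
    exact (hn.div hd (by norm_num)).congr_deriv (by norm_num)
  have h2 := h1.const_rpow hx
  have h3 := (h2.mul h2).tendsto_slope_zero
  refine ((h3.mono_left (nhdsWithin_mono _ fun t ht => (ne_of_gt ht))).congr fun t => ?_).trans_eq
    ?_
  · simp
  · congr 1
    simp
    ring

lemma tendsto_trace_sandOp_slope {ρ σ K : Matrix ι ι ℂ} (hρ : ρ.PosSemidef) (hσ : σ.PosSemidef)
    (hK : ρ = K * σ) :
    Tendsto (fun t : ℝ => t⁻¹ * ((sandOp (1 + t) ρ σ).trace.re - ρ.trace.re)) (𝓝[>] 0)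
      (𝓝 (-(ρ * cfc Real.log σ).trace.re)) := by
  obtain ⟨w, hw⟩ := exists_trace_mul_cfc_eq_sum hρ.1 hσ.1
  have hsupp : ∀ g : ℝ → ℝ, (ρ * cfc g σ).trace.re =
      ∑ j, w j * ((hσ.1.eigenvalues j)⁻¹ * hσ.1.eigenvalues j * g (hσ.1.eigenvalues j)) := by
    intro g
    rw [← hw fun x : ℝ => x⁻¹ * x * g x, ← cfc_mul_cfc (fun x : ℝ => x⁻¹ * x), ← suppProj,
      ← mul_assoc, mul_suppProj_of_eq_mul hσ.1 hK]
  have htr : ρ.trace.re = ∑ j, w j * ((hσ.1.eigenvalues j)⁻¹ * hσ.1.eigenvalues j * 1) := by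
    rw [← mul_suppProj_of_eq_mul hσ.1 hK, suppProj, hw]
    simp only [mul_one]
  have hop : ∀ t : ℝ, (sandOp (1 + t) ρ σ).trace.re = (ρ * cfc (fun x : ℝ =>
      x ^ ((1 - (1 + t)) / (2 * (1 + t))) * x ^ ((1 - (1 + t)) / (2 * (1 + t)))) σ).trace.re := by
    intro t
    rw [sandOp, mul_assoc, Matrix.trace_mul_comm, mul_assoc, cfc_mul_cfc]
  simp only [hop, hsupp, htr, ← Finset.sum_sub_distrib, Finset.mul_sum]
  rw [← Finset.sum_neg_distrib]
  refine tendsto_finsetSum _ fun j _ => ?_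
  rcases (hσ.eigenvalues_nonneg j).eq_or_lt with h0 | h0
  · simp [← h0]
  · have h1 := (tendsto_slope_rpow_mul_rpow h0).const_mul (w j)
    rw [inv_mul_cancel₀ h0.ne']
    refine (h1.congr fun t => ?_).trans_eq ?_
    · ring
    · congr 1; ring

/-- The secant slope at exponent `1` of `t ↦ x ^ (1 + t)`. -/
def rpowSecant (t x : ℝ) : ℝ := t⁻¹ * (x ^ (1 + t) - x)

lemma rpowSecant_mono {x : ℝ} (hx : 0 ≤ x) {t u : ℝ} (ht : 0 < t) (htu : t ≤ u) :
    rpowSecant t x ≤ rpowSecant u x := by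
  have hu : 0 < u := ht.trans_le htu
  rcases hx.eq_or_lt with rfl | hx0
  · simp [rpowSecant, Real.zero_rpow (by linarith : 1 + t ≠ 0),
      Real.zero_rpow (by linarith : 1 + u ≠ 0)]
  · have hb := rpow_one_add_le_one_add_mul_self (s := x ^ u - 1) (p := t / u)
      (by linarith [Real.rpow_nonneg hx u]) (by positivity) ((div_le_one hu).2 htu)
    rw [add_sub_cancel, ← Real.rpow_mul hx, mul_div_cancel₀ _ hu.ne'] at hb
    have h1 : t⁻¹ * (x ^ t - 1) ≤ u⁻¹ * (x ^ u - 1) := by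
      rw [inv_mul_le_iff₀ ht]
      calc x ^ t - 1 ≤ t / u * (x ^ u - 1) := by linarith
        _ = t * (u⁻¹ * (x ^ u - 1)) := by ring
    have h2 := mul_le_mul_of_nonneg_left h1 hx
    simp only [rpowSecant, Real.rpow_add hx0, Real.rpow_one]
    linarith

lemma continuous_rpowSecant {t : ℝ} (ht : 0 < t) : Continuous (rpowSecant t) := by
  unfold rpowSecant
  exact continuous_const.mul ((Real.continuous_rpow_const (by linarith)).sub continuous_id)

lemma tendsto_rpowSecant {x : ℝ} (hx : 0 ≤ x) :
    Tendsto (fun t => rpowSecant t x) (𝓝[>] 0) (𝓝 (x * Real.log x)) := by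
  rcases hx.eq_or_lt with rfl | hx0
  · refine tendsto_const_nhds.congr' ?_
    filter_upwards [self_mem_nhdsWithin] with t (ht : 0 < t)
    simp [rpowSecant, Real.zero_rpow (by linarith : 1 + t ≠ 0)]
  · have h := (((hasDerivAt_id (0 : ℝ)).const_add 1).const_rpow hx0).tendsto_slope_zero
    refine ((h.mono_left (nhdsWithin_mono _ fun t ht => (ne_of_gt ht))).congr fun t => ?_).trans_eq
      ?_
    · simp [rpowSecant]
    · congr 1
      simp [mul_comm]

lemma sandQ_one_add_eq {ρ : Matrix ι ι ℂ} (hρ : ρ.PosSemidef) (σ : Matrix ι ι ℂ) (t : ℝ) :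
    t⁻¹ * (sandQ (1 + t) ρ σ - (sandOp (1 + t) ρ σ).trace.re) =
      (cfc (rpowSecant t) (sandOp (1 + t) ρ σ)).trace.re := by
  have hX := posSemidef_sandOp hρ (1 + t) σ
  have h : (sandOp (1 + t) ρ σ).trace.re = ∑ i, hX.1.eigenvalues i := by
    conv_lhs => rw [← cfc_self hX.1]
    exact trace_cfc hX.1 _
  rw [h, sandQ, trace_cfc hX.1, trace_cfc hX.1, ← Finset.sum_sub_distrib, Finset.mul_sum]
  rfl

lemma sandQ_pos {ρ σ K : Matrix ι ι ℂ} (hρ : ρ.PosSemidef) (hρ1 : ρ.trace = 1)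
    (hσ : σ.PosSemidef) (hK : ρ = K * σ) {α : ℝ} (hα : 1 < α) : 0 < sandQ α ρ σ := by
  refine (sandQ_nonneg hρ α σ).lt_of_ne fun h => ?_
  have := trace_mul_le_sandQ hρ hσ hK PosSemidef.one (by rw [sub_self]; exact PosSemidef.zero) hα
  rw [mul_one, hρ1, ← h, Real.zero_rpow (by positivity), zero_mul] at this
  norm_num at this

/-- The sandwiched Rényi divergences of order `α ↓ 1` are asymptotically bounded by the Umegaki
relative entropy. -/
lemma exists_sandwiched_lt {ρ σ K : Matrix ι ι ℂ} (hρ : ρ.PosSemidef) (hρ1 : ρ.trace = 1)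
    (hσ : σ.PosSemidef) (hK : ρ = K * σ) {R : ℝ}
    (hR : (ρ * (cfc (Real.logb 2) ρ - cfc (Real.logb 2) σ)).trace.re < R) :
    ∃ α, 1 < α ∧ (α - 1)⁻¹ * Real.logb 2 (sandQ α ρ σ) < R := by
  have hl2 : 0 < Real.log 2 := Real.log_pos one_lt_two
  have hlogb : ∀ τ : Matrix ι ι ℂ, τ.IsHermitian →
      (ρ * cfc (Real.logb 2) τ).trace.re * Real.log 2 = (ρ * cfc Real.log τ).trace.re := by
    intro τ hτ
    obtain ⟨w, hw⟩ := exists_trace_mul_cfc_eq_sum hρ.1 hτ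
    rw [hw, hw, Finset.sum_mul]
    refine Finset.sum_congr rfl fun j _ => ?_
    rw [Real.logb, mul_assoc, div_mul_cancel₀ _ hl2.ne']
  have hR' : (ρ * cfc Real.log ρ).trace.re - (ρ * cfc Real.log σ).trace.re < R * Real.log 2 := by
    rw [← hlogb ρ hρ.1, ← hlogb σ hσ.1, ← sub_mul, ← Complex.sub_re, ← trace_sub, ← mul_sub]
    exact mul_lt_mul_of_pos_right hR hl2
  have hent : (ρ * cfc Real.log ρ).trace.re =
      ∑ i, hρ.1.eigenvalues i * Real.log (hρ.1.eigenvalues i) := by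
    rw [← trace_cfc hρ.1 fun x => x * Real.log x, ← cfc_mul_cfc (fun x : ℝ => x), cfc_self hρ.1]
  obtain ⟨u, hu, hu0⟩ : ∃ u : ℝ, (cfc (rpowSecant u) ρ).trace.re - (ρ * cfc Real.log σ).trace.re
      < R * Real.log 2 ∧ 0 < u := by
    have hlim : Tendsto (fun u => (cfc (rpowSecant u) ρ).trace.re -
        (ρ * cfc Real.log σ).trace.re) (𝓝[>] 0)
        (𝓝 ((ρ * cfc Real.log ρ).trace.re - (ρ * cfc Real.log σ).trace.re)) := by
      simp only [hent, trace_cfc hρ.1]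
      exact (tendsto_finsetSum _ fun i _ =>
        tendsto_rpowSecant (hρ.eigenvalues_nonneg i)).sub_const _
    exact ((hlim.eventually_lt_const hR').and self_mem_nhdsWithin).exists
  have hcts : Continuous fun X : Matrix ι ι ℂ => X.trace.re := by fun_prop
  have hX := tendsto_sandOp hρ.1 hσ hK
  have h1 := (hcts.tendsto _).comp (tendsto_cfc_of_continuous hX
    (Eventually.of_forall fun t => (posSemidef_sandOp hρ (1 + t) σ).1) hρ.1
    (continuous_rpowSecant hu0))
  have h2 := (h1.add (tendsto_trace_sandOp_slope hρ hσ hK)).eventually_lt_const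
    (by rwa [← sub_eq_add_neg] : _ < R * Real.log 2)
  obtain ⟨t, ht, ht0, htu⟩ := (h2.and (Ioo_mem_nhdsGT hu0)).exists
  refine ⟨1 + t, by linarith, ?_⟩
  have hXt := posSemidef_sandOp hρ (1 + t) σ
  have h3 : (cfc (rpowSecant t) (sandOp (1 + t) ρ σ)).trace.re ≤
      (cfc (rpowSecant u) (sandOp (1 + t) ρ σ)).trace.re := by
    rw [trace_cfc hXt.1, trace_cfc hXt.1]
    exact Finset.sum_le_sum fun i _ => rpowSecant_mono (hXt.eigenvalues_nonneg i) ht0 htu.le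
  rw [← sandQ_one_add_eq hρ σ t] at h3
  have h4 := Real.log_le_sub_one_of_pos (sandQ_pos hρ hρ1 hσ hK (by linarith : 1 < 1 + t))
  have h5 := mul_le_mul_of_nonneg_left h4 (inv_nonneg.2 ht0.le)
  simp only [Function.comp_apply, hρ1, Complex.one_re] at ht
  rw [add_sub_cancel_left, Real.logb, ← mul_div_assoc, div_lt_iff₀ hl2]
  linarith

end LimitAlphaToOne

section TensorPowers

variable {d m n : ℕ}

lemma cfc_eq_of_eq_conj {ι : Type*} [Fintype ι] [DecidableEq ι] {A V : Matrix ι ι ℂ}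
    (hA : A.IsHermitian) (hV : Vᴴ * V = 1) {a : ι → ℝ}
    (h : A = V * diagonal (fun i => ((a i : ℝ) : ℂ)) * Vᴴ) (f : ℝ → ℝ) :
    cfc f A = V * diagonal (fun i => ((f (a i) : ℝ) : ℂ)) * Vᴴ := by
  have hU := eigenvectorUnitary_conjTranspose_mul hA
  have hA' := eq_conj hA
  rw [cfc_eq_conj hA]
  set U := (hA.eigenvectorUnitary : Matrix ι ι ℂ)
  have hU' : U * Uᴴ = 1 := mul_eq_one_comm.mp hU
  have hV' : V * Vᴴ = 1 := mul_eq_one_comm.mp hV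
  have hcomm : diagonal (fun i => ((hA.eigenvalues i : ℝ) : ℂ)) * (Uᴴ * V) =
      (Uᴴ * V) * diagonal (fun i => ((a i : ℝ) : ℂ)) := by
    calc _ = (Uᴴ * U) * diagonal (fun i => ((hA.eigenvalues i : ℝ) : ℂ)) * (Uᴴ * V) := by
          rw [hU, one_mul]
      _ = Uᴴ * (U * diagonal (fun i => ((hA.eigenvalues i : ℝ) : ℂ)) * Uᴴ) * V := by
          simp only [mul_assoc]
      _ = Uᴴ * (V * diagonal (fun i => ((a i : ℝ) : ℂ)) * Vᴴ) * V := by rw [← hA', ← h]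
      _ = (Uᴴ * V) * diagonal (fun i => ((a i : ℝ) : ℂ)) * (Vᴴ * V) := by simp only [mul_assoc]
      _ = _ := by rw [hV, mul_one]
  have hcommf : diagonal (fun i => ((f (hA.eigenvalues i) : ℝ) : ℂ)) * (Uᴴ * V) =
      (Uᴴ * V) * diagonal (fun i => ((f (a i) : ℝ) : ℂ)) := by
    ext i j
    have hij := congrFun (congrFun hcomm i) j
    rw [diagonal_mul, mul_diagonal] at hij ⊢
    by_cases hW : (Uᴴ * V) i j = 0
    · rw [hW, mul_zero, zero_mul]
    · rw [mul_comm] at hij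
      rw [Complex.ofReal_injective (mul_left_cancel₀ hW hij), mul_comm]
  calc U * diagonal (fun i => ((f (hA.eigenvalues i) : ℝ) : ℂ)) * Uᴴ
      = U * diagonal (fun i => ((f (hA.eigenvalues i) : ℝ) : ℂ)) * Uᴴ * (V * Vᴴ) := by
        rw [hV', mul_one]
    _ = U * (diagonal (fun i => ((f (hA.eigenvalues i) : ℝ) : ℂ)) * (Uᴴ * V)) * Vᴴ := by
        simp only [mul_assoc]
    _ = (U * Uᴴ) * V * diagonal (fun i => ((f (a i) : ℝ) : ℂ)) * Vᴴ := by
        rw [hcommf]; simp only [mul_assoc]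
    _ = _ := by rw [hU', one_mul]

lemma tensorProd_eq_submatrix_kronecker (A : Mat d m) (B : Mat d n) :
    tensorProd A B = (kroneckerMap (· * ·) A B).submatrix (Fin.appendEquiv m n).symm
      (Fin.appendEquiv m n).symm := rfl

lemma tensorProd_mul (A A' : Mat d m) (B B' : Mat d n) :
    tensorProd A B * tensorProd A' B' = tensorProd (A * A') (B * B') := by
  simp only [tensorProd_eq_submatrix_kronecker]
  rw [submatrix_mul_equiv, ← mul_kronecker_mul]

lemma trace_tensorProd (A : Mat d m) (B : Mat d n) :
    (tensorProd A B).trace = A.trace * B.trace := by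
  rw [tensorProd_eq_submatrix_kronecker, ← trace_kronecker A B]
  exact (Fin.appendEquiv m n).symm.sum_comp fun x => kroneckerMap (· * ·) A B x x

lemma conjTranspose_tensorProd (A : Mat d m) (B : Mat d n) :
    (tensorProd A B)ᴴ = tensorProd Aᴴ Bᴴ := by
  ext f g
  simp [tensorProd, conjTranspose_apply]

lemma tensorProd_diagonal (a : TIdx d m → ℂ) (b : TIdx d n → ℂ) :
    tensorProd (diagonal a) (diagonal b) = diagonal fun f =>
      a (fun i => f (Fin.castAdd n i)) * b (fun j => f (Fin.natAdd m j)) := by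
  rw [tensorProd_eq_submatrix_kronecker]
  have := diagonal_kronecker_diagonal a b
  rw [this, submatrix_diagonal_equiv]
  rfl

lemma tensorProd_one : tensorProd (1 : Mat d m) (1 : Mat d n) = 1 := by
  rw [← diagonal_one, ← diagonal_one, tensorProd_diagonal]
  simp

lemma tensorProd_smul_one (a b : ℝ) :
    tensorProd (a • (1 : Mat d m)) (b • (1 : Mat d n)) = (a * b) • 1 := by
  rw [← tensorProd_one]
  ext f g
  simp only [tensorProd, of_apply, Matrix.smul_apply, Complex.real_smul, Complex.ofReal_mul]
  ring

lemma posSemidef_tensorProd {A : Mat d m} {B : Mat d n} (hA : A.PosSemidef) (hB : B.PosSemidef) :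
    (tensorProd A B).PosSemidef := by
  rw [tensorProd_eq_submatrix_kronecker]
  exact (hA.kronecker hB).submatrix _

lemma cfc_rpow_tensorProd {A : Mat d m} {B : Mat d n} (hA : A.PosSemidef) (hB : B.PosSemidef)
    (p : ℝ) :
    cfc (fun x : ℝ => x ^ p) (tensorProd A B) =
      tensorProd (cfc (fun x : ℝ => x ^ p) A) (cfc (fun x : ℝ => x ^ p) B) := by
  set U := (hA.1.eigenvectorUnitary : Mat d m) with hU
  set V := (hB.1.eigenvectorUnitary : Mat d n) with hV
  have key : ∀ g : ℝ → ℝ, tensorProd (cfc g A) (cfc g B) = tensorProd U V *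
      diagonal (fun f : TIdx d (m + n) =>
        ((g (hA.1.eigenvalues fun i => f (Fin.castAdd n i)) *
          g (hB.1.eigenvalues fun j => f (Fin.natAdd m j)) : ℝ) : ℂ)) * (tensorProd U V)ᴴ := by
    intro g
    simp only [Complex.ofReal_mul]
    rw [← tensorProd_diagonal (fun f => ((g (hA.1.eigenvalues f) : ℝ) : ℂ))
      (fun f => ((g (hB.1.eigenvalues f) : ℝ) : ℂ)), conjTranspose_tensorProd, tensorProd_mul,
      tensorProd_mul, cfc_eq_conj hA.1, cfc_eq_conj hB.1]
  have hW : (tensorProd U V)ᴴ * tensorProd U V = 1 := by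
    rw [conjTranspose_tensorProd, tensorProd_mul, hU, hV, eigenvectorUnitary_conjTranspose_mul,
      eigenvectorUnitary_conjTranspose_mul, tensorProd_one]
  have h1 := key fun x => x
  rw [cfc_self hA.1, cfc_self hB.1] at h1
  rw [cfc_eq_of_eq_conj (posSemidef_tensorProd hA hB).1 hW h1, key]
  simp only [Real.mul_rpow (hA.eigenvalues_nonneg _) (hB.eigenvalues_nonneg _)]

lemma sandQ_tensorProd {ρ₁ σ₁ : Mat d m} {ρ₂ σ₂ : Mat d n} (hρ₁ : ρ₁.PosSemidef)
    (hσ₁ : σ₁.PosSemidef) (hρ₂ : ρ₂.PosSemidef) (hσ₂ : σ₂.PosSemidef) (α : ℝ) :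
    sandQ α (tensorProd ρ₁ ρ₂) (tensorProd σ₁ σ₂) = sandQ α ρ₁ σ₁ * sandQ α ρ₂ σ₂ := by
  have hop : sandOp α (tensorProd ρ₁ ρ₂) (tensorProd σ₁ σ₂) =
      tensorProd (sandOp α ρ₁ σ₁) (sandOp α ρ₂ σ₂) := by
    simp only [sandOp, cfc_rpow_tensorProd hσ₁ hσ₂, tensorProd_mul]
  have hreal : ∀ {k : ℕ} (τ : Mat d k), (cfc (fun x : ℝ => x ^ α) τ).trace.im = 0 := by
    intro k τ
    have h := congrArg Complex.im (trace_conjTranspose (cfc (fun x : ℝ => x ^ α) τ))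
    rw [(isHermitian_cfc _ τ).eq, Complex.star_def, Complex.conj_im] at h
    linarith
  rw [sandQ, hop, cfc_rpow_tensorProd (posSemidef_sandOp hρ₁ α σ₁) (posSemidef_sandOp hρ₂ α σ₂),
    trace_tensorProd, Complex.mul_re, hreal, zero_mul, sub_zero]
  rfl

lemma mpow_eq_cfc {A : Mat d n} (hA : A.IsHermitian) (p : ℝ) :
    mpow A p = cfc (fun x : ℝ => x ^ p) A := by
  rw [mpow, dif_pos hA, cfc_eq_conj hA]
  rfl

lemma mlog_eq_cfc {A : Mat d n} (hA : A.IsHermitian) : mlog A = cfc (Real.logb 2) A := by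
  rw [mlog, dif_pos hA, cfc_eq_conj hA]
  rfl

lemma qSand_eq_sandQ {ρ σ : Mat d n} (hρ : ρ.PosSemidef) (hσ : σ.PosSemidef) (α : ℝ) :
    qSand α ρ σ = sandQ α ρ σ := by
  rw [qSand, mpow_eq_cfc hσ.1, ← sandOp, mpow_eq_cfc (posSemidef_sandOp hρ α σ).1, sandQ]

lemma suppLE_tensorProd {ρ₁ σ₁ : Mat d m} {ρ₂ σ₂ : Mat d n} (hσ₁ : σ₁.PosSemidef)
    (hσ₂ : σ₂.PosSemidef) (h₁ : suppLE ρ₁ σ₁) (h₂ : suppLE ρ₂ σ₂) :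
    suppLE (tensorProd ρ₁ ρ₂) (tensorProd σ₁ σ₂) := by
  obtain ⟨K₁, rfl⟩ := (exists_eq_mul_iff hσ₁.1).2 h₁
  obtain ⟨K₂, rfl⟩ := (exists_eq_mul_iff hσ₂.1).2 h₂
  rw [← tensorProd_mul]
  exact (exists_eq_mul_iff (posSemidef_tensorProd hσ₁ hσ₂).1).1 ⟨_, rfl⟩

end TensorPowers

section SetDivergences

variable {d n : ℕ}

/-- The finite values of the sandwiched Rényi divergence between elements of two sets. -/
def sandVals (α : ℝ) (A B : Set (Mat d n)) : Set ℝ :=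
  {x | ∃ ρ ∈ A, ∃ σ ∈ B, suppLE ρ σ ∧ x = (α - 1)⁻¹ * Real.logb 2 (qSand α ρ σ)}

lemma DSandSet_eq_coe_sInf {α : ℝ} {A B : Set (Mat d n)} (hne : (sandVals α A B).Nonempty)
    (hbdd : BddBelow (sandVals α A B)) :
    DSandSet α A B = ((sInf (sandVals α A B) : ℝ) : EReal) := by
  apply le_antisymm
  · have hle : ∀ x ∈ sandVals α A B, DSandSet α A B ≤ (x : EReal) := by
      rintro _ ⟨ρ, hρ, σ, hσ, hs, rfl⟩
      refine (iInf₂_le_of_le ρ hρ (iInf₂_le σ hσ)).trans ?_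
      rw [DSand, if_pos hs]
    generalize DSandSet α A B = y at hle
    induction y with
    | bot => exact bot_le
    | top =>
      obtain ⟨x, hx⟩ := hne
      exact absurd (hle x hx) (by simp)
    | coe y =>
      exact EReal.coe_le_coe_iff.2 (le_csInf hne fun x hx => EReal.coe_le_coe_iff.1 (hle x hx))
  · refine le_iInf₂ fun ρ hρ => le_iInf₂ fun σ hσ => ?_
    rw [DSand]
    split_ifs with hs
    · exact EReal.coe_le_coe_iff.2 (csInf_le hbdd ⟨ρ, hρ, σ, hσ, hs, rfl⟩)
    · exact le_top

lemma logb_le_of_le_rpow_mul_rpow {p Q q α : ℝ} (hp : 0 < p) (hQ : 0 < Q) (hq : 0 < q)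
    (hα : 1 < α) (h : p ≤ Q ^ (1 / α) * q ^ ((α - 1) / α)) :
    Real.logb 2 p ≤ (α - 1) / α * ((α - 1)⁻¹ * Real.logb 2 Q + Real.logb 2 q) := by
  have hα0 : α ≠ 0 := by positivity
  have hα1 : α - 1 ≠ 0 := (sub_pos.2 hα).ne'
  refine (Real.logb_le_logb_of_le one_lt_two hp h).trans_eq ?_
  rw [Real.logb_mul (Real.rpow_pos_of_pos hQ _).ne' (Real.rpow_pos_of_pos hq _).ne',
    Real.logb_rpow_eq_mul_logb_of_pos hQ, Real.logb_rpow_eq_mul_logb_of_pos hq]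
  field_simp

lemma trace_mul_re_nonneg {σ M : Mat d n} (hσ : σ.PosSemidef) (hM : M.PosSemidef) :
    0 ≤ (σ * M).trace.re := by
  have h := trace_cfc_mul_cfc hσ.1 hM.1 (fun x : ℝ => x) (fun x : ℝ => x)
  rw [cfc_self hσ.1, cfc_self hM.1] at h
  rw [h]
  exact Finset.sum_nonneg fun i _ => Finset.sum_nonneg fun j _ => mul_nonneg
    (mul_nonneg (hσ.eigenvalues_nonneg i) (hM.eigenvalues_nonneg j)) (sq_nonneg _)

lemma qSand_pos {ρ σ : Mat d n} (hρ : IsState ρ) (hσ : σ.PosSemidef) (h : suppLE ρ σ) {α : ℝ}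
    (hα : 1 < α) : 0 < qSand α ρ σ := by
  obtain ⟨K, hK⟩ := (exists_eq_mul_iff hσ.1).2 h
  rw [qSand_eq_sandQ hρ.1 hσ]
  exact sandQ_pos hρ.1 hρ.2 hσ hK hα

lemma trace_mul_le_qSand {ρ σ M : Mat d n} (hρ : IsState ρ) (hσ : σ.PosSemidef)
    (h : suppLE ρ σ) (hM : IsTest M) {α : ℝ} (hα : 1 < α) :
    (ρ * M).trace.re ≤ qSand α ρ σ ^ (1 / α) * (σ * M).trace.re ^ ((α - 1) / α) := by
  obtain ⟨K, hK⟩ := (exists_eq_mul_iff hσ.1).2 h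
  rw [qSand_eq_sandQ hρ.1 hσ]
  exact trace_mul_le_sandQ hρ.1 hσ hK hM.1 hM.2 hα

lemma isTest_one : IsTest (1 : Mat d n) :=
  ⟨PosSemidef.one, by rw [sub_self]; exact PosSemidef.zero⟩

lemma isTest_zero : IsTest (0 : Mat d n) :=
  ⟨PosSemidef.zero, by rw [sub_zero]; exact PosSemidef.one⟩

lemma neg_logb_le_sandwiched {ρ σ : Mat d n} (hρ : IsState ρ) (hσ : σ.PosSemidef)
    (h : suppLE ρ σ) {C : ℝ} (hC : 0 < C) (hσC : σ.trace.re ≤ C) {α : ℝ} (hα : 1 < α) :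
    -Real.logb 2 C ≤ (α - 1)⁻¹ * Real.logb 2 (qSand α ρ σ) := by
  have hQ := qSand_pos hρ hσ h hα
  have hα' : 0 < (α - 1) / α := div_pos (sub_pos.2 hα) (by linarith)
  have h1 := trace_mul_le_qSand hρ hσ h isTest_one hα
  simp only [mul_one, hρ.2, Complex.one_re] at h1
  have htr : 0 ≤ σ.trace.re := (Complex.nonneg_iff.1 hσ.trace_nonneg).1
  have h2 := logb_le_of_le_rpow_mul_rpow one_pos hQ hC hα (h1.trans (by gcongr))
  rw [Real.logb_one] at h2
  linarith [(mul_nonneg_iff_of_pos_left hα').1 h2]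

lemma exists_suppLE_of_DmaxSet_lt_top {A B : Set (Mat d n)} (hA : ∀ ρ ∈ A, ρ.PosSemidef)
    (h : DmaxSet A B < ⊤) : ∃ ρ ∈ A, ∃ σ ∈ B, suppLE ρ σ := by
  simp only [DmaxSet, iInf_lt_iff] at h
  obtain ⟨ρ, hρ, σ, hσ, l, hl, -⟩ := h
  refine ⟨ρ, hρ, σ, hσ, fun v hv => ?_⟩
  refine ((hA ρ hρ).dotProduct_mulVec_zero_iff v).1
    (le_antisymm ?_ ((hA ρ hρ).dotProduct_mulVec_nonneg v))
  have := hl.2.dotProduct_mulVec_nonneg v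
  rw [sub_mulVec, smul_mulVec, hv, smul_zero, zero_sub, dotProduct_neg] at this
  exact neg_nonneg.1 this

lemma exists_trace_le (B : ∀ n : ℕ, Set (Mat d n)) (hcomp : ∀ n, IsCompact (B n))
    (hpolar : Stable fun n => polar (B n)) :
    ∃ S T : ℝ, 0 < S ∧ 0 < T ∧ ∀ n, ∀ σ ∈ B n, σ.trace.re ≤ S * T ^ n := by
  have hbd : ∀ n, ∃ T : ℝ, 0 < T ∧ T⁻¹ • (1 : Mat d n) ∈ polar (B n) := by
    intro n
    have hcont : Continuous fun σ : Mat d n => σ.trace.re :=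
      Complex.continuous_re.comp continuous_id.matrix_trace
    obtain ⟨T, hT⟩ := (hcomp n).bddAbove_image hcont.continuousOn
    have hT0 : 0 < max T 1 := lt_max_of_lt_right one_pos
    refine ⟨max T 1, hT0, PosSemidef.one.smul (inv_nonneg.2 hT0.le), fun σ hσ => ?_⟩
    rw [smul_mul_assoc, one_mul, trace_smul, Complex.smul_re, smul_eq_mul, inv_mul_le_iff₀ hT0,
      mul_one]
    exact (hT ⟨σ, hσ, rfl⟩).trans (le_max_left _ _)
  obtain ⟨S, hS, hS'⟩ := hbd 0
  obtain ⟨T, hT, hT'⟩ := hbd 1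
  have hmem : ∀ n, (S * T ^ n)⁻¹ • (1 : Mat d n) ∈ polar (B n) := by
    intro n
    induction n with
    | zero => simpa using hS'
    | succ n ih =>
      have := hpolar n 1 _ ih _ hT'
      rwa [tensorProd_smul_one, ← mul_inv, mul_assoc, ← pow_succ] at this
  refine ⟨S, T, hS, hT, fun n σ hσ => ?_⟩
  have := (hmem n).2 σ hσ
  rwa [smul_mul_assoc, one_mul, trace_smul, Complex.smul_re, smul_eq_mul,
    inv_mul_le_iff₀ (by positivity), mul_one] at this

lemma sInf_sandVals_add_le {m : ℕ} {α : ℝ} (hα : 1 < α) {A₁ B₁ : Set (Mat d m)}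
    {A₂ B₂ : Set (Mat d n)} {A₃ B₃ : Set (Mat d (m + n))}
    (hA₁ : ∀ ρ ∈ A₁, IsState ρ) (hA₂ : ∀ ρ ∈ A₂, IsState ρ)
    (hB₁ : ∀ σ ∈ B₁, σ.PosSemidef) (hB₂ : ∀ σ ∈ B₂, σ.PosSemidef)
    (hA : ∀ X ∈ A₁, ∀ Y ∈ A₂, tensorProd X Y ∈ A₃) (hB : ∀ X ∈ B₁, ∀ Y ∈ B₂, tensorProd X Y ∈ B₃)
    (h₁ : (sandVals α A₁ B₁).Nonempty) (h₂ : (sandVals α A₂ B₂).Nonempty)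
    (hbdd : BddBelow (sandVals α A₃ B₃)) :
    sInf (sandVals α A₃ B₃) ≤ sInf (sandVals α A₁ B₁) + sInf (sandVals α A₂ B₂) := by
  rw [← sub_le_iff_le_add]
  refine le_csInf h₁ ?_
  rintro _ ⟨ρ₁, hρ₁, σ₁, hσ₁, hs₁, rfl⟩
  rw [sub_le_comm]
  refine le_csInf h₂ ?_
  rintro _ ⟨ρ₂, hρ₂, σ₂, hσ₂, hs₂, rfl⟩
  rw [sub_le_iff_le_add']
  refine csInf_le hbdd ⟨_, hA _ hρ₁ _ hρ₂, _, hB _ hσ₁ _ hσ₂,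
    suppLE_tensorProd (hB₁ _ hσ₁) (hB₂ _ hσ₂) hs₁ hs₂, ?_⟩
  have hq₁ := qSand_pos (hA₁ _ hρ₁) (hB₁ _ hσ₁) hs₁ hα
  have hq₂ := qSand_pos (hA₂ _ hρ₂) (hB₂ _ hσ₂) hs₂ hα
  rw [qSand_eq_sandQ (posSemidef_tensorProd (hA₁ _ hρ₁).1 (hA₂ _ hρ₂).1)
    (posSemidef_tensorProd (hB₁ _ hσ₁) (hB₂ _ hσ₂)),
    sandQ_tensorProd (hA₁ _ hρ₁).1 (hB₁ _ hσ₁) (hA₂ _ hρ₂).1 (hB₂ _ hσ₂),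
    ← qSand_eq_sandQ (hA₁ _ hρ₁).1 (hB₁ _ hσ₁), ← qSand_eq_sandQ (hA₂ _ hρ₂).1 (hB₂ _ hσ₂),
    Real.logb_mul hq₁.ne' hq₂.ne']
  ring

end SetDivergences

section StrongConverse

variable {d n : ℕ}

lemma bddAbove_range_iSup_mem {C : Set (Mat d n)} (hC : IsCompact C) {g : Mat d n → ℝ}
    (hg : Continuous g) : BddAbove (Set.range fun x => ⨆ _ : x ∈ C, g x) := by
  obtain ⟨T, hT⟩ := hC.bddAbove_image hg.continuousOn
  refine ⟨max T 0, ?_⟩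
  rintro _ ⟨x, rfl⟩
  by_cases hx : x ∈ C
  · simp only [hx, ciSup_unique]
    exact (hT ⟨x, hx, rfl⟩).trans (le_max_left _ _)
  · simp [hx]

lemma le_iSup_mem_of_isCompact {C : Set (Mat d n)} (hC : IsCompact C) {g : Mat d n → ℝ}
    (hg : Continuous g) {x : Mat d n} (hx : x ∈ C) : g x ≤ ⨆ y ∈ C, g y := by
  refine le_trans ?_ (le_ciSup (bddAbove_range_iSup_mem hC hg) x)
  simp [hx]

lemma typeI_le {A : Set (Mat d n)} {M : Mat d n} {a : ℝ} (ha : 0 ≤ a)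
    (h : ∀ ρ ∈ A, (ρ * (1 - M)).trace.re ≤ a) : typeI A M ≤ a :=
  Real.iSup_le (fun ρ => Real.iSup_le (h ρ) ha) ha

lemma typeI_nonneg {A : Set (Mat d n)} (hA : ∀ ρ ∈ A, IsState ρ) {M : Mat d n} (hM : IsTest M) :
    0 ≤ typeI A M :=
  Real.iSup_nonneg fun ρ => Real.iSup_nonneg fun hρ => trace_mul_re_nonneg (hA ρ hρ).1 hM.2

lemma typeII_zero (B : Set (Mat d n)) : typeII B (0 : Mat d n) = 0 := by
  simp [typeII]

lemma optAlpha_le_one {A : Set (Mat d n)} (hA : ∀ ρ ∈ A, IsState ρ) (r : ℝ) (B : Set (Mat d n)) :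
    optAlpha n r A B ≤ 1 := by
  have hbdd : BddBelow {x | ∃ M : Mat d n, IsTest M ∧
      typeII B M ≤ (2 : ℝ) ^ (-((n : ℝ) * r)) ∧ x = typeI A M} := by
    refine ⟨0, ?_⟩
    rintro _ ⟨M, hM, -, rfl⟩
    exact typeI_nonneg hA hM
  refine (csInf_le hbdd ⟨0, isTest_zero, by rw [typeII_zero]; positivity, rfl⟩).trans
    (typeI_le zero_le_one fun ρ hρ => ?_)
  rw [sub_zero, mul_one, (hA ρ hρ).2, Complex.one_re]

lemma one_sub_optAlpha_le {A B : Set (Mat d n)} (hAc : IsCompact A) (hBc : IsCompact B)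
    (hA : ∀ ρ ∈ A, IsState ρ) (hB : ∀ σ ∈ B, σ.PosSemidef) {ρ σ : Mat d n} (hρ : ρ ∈ A)
    (hσ : σ ∈ B) (h : suppLE ρ σ) (r : ℝ) {α : ℝ} (hα : 1 < α) :
    1 - optAlpha n r A B ≤
      qSand α ρ σ ^ (1 / α) * ((2 : ℝ) ^ (-((n : ℝ) * r))) ^ ((α - 1) / α) := by
  rw [sub_le_comm]
  refine le_csInf ⟨_, 0, isTest_zero, by rw [typeII_zero]; positivity, rfl⟩ ?_
  rintro _ ⟨M, hM, hM2, rfl⟩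
  have hcI : Continuous fun τ : Mat d n => (τ * (1 - M)).trace.re :=
    Complex.continuous_re.comp (continuous_id.matrix_mul continuous_const).matrix_trace
  have hcII : Continuous fun τ : Mat d n => (τ * M).trace.re :=
    Complex.continuous_re.comp (continuous_id.matrix_mul continuous_const).matrix_trace
  have h1 : (ρ * (1 - M)).trace.re ≤ typeI A M := le_iSup_mem_of_isCompact hAc hcI hρ
  have h2 : (σ * M).trace.re ≤ (2 : ℝ) ^ (-((n : ℝ) * r)) :=
    (le_iSup_mem_of_isCompact hBc hcII hσ).trans hM2
  have h3 := trace_mul_le_qSand (hA ρ hρ) (hB σ hσ) h hM hα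
  rw [mul_sub, mul_one, trace_sub, Complex.sub_re, (hA ρ hρ).2, Complex.one_re] at h1
  have hQ := (qSand_pos (hA ρ hρ) (hB σ hσ) h hα).le
  have h0 := trace_mul_re_nonneg (hB σ hσ) hM.1
  have hα' : 0 ≤ (α - 1) / α := div_nonneg (by linarith) (by linarith)
  have h4 : qSand α ρ σ ^ (1 / α) * (σ * M).trace.re ^ ((α - 1) / α) ≤
      qSand α ρ σ ^ (1 / α) * ((2 : ℝ) ^ (-((n : ℝ) * r))) ^ ((α - 1) / α) := by
    gcongr
  linarith

lemma le_negLog2_one_sub_optAlpha {A B : Set (Mat d n)} (hAc : IsCompact A) (hBc : IsCompact B)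
    (hA : ∀ ρ ∈ A, IsState ρ) (hB : ∀ σ ∈ B, σ.PosSemidef) (r : ℝ) {α : ℝ} (hα : 1 < α)
    (hne : (sandVals α A B).Nonempty) :
    (((α - 1) / α * (n * r - sInf (sandVals α A B)) : ℝ) : EReal) ≤
      negLog2 (1 - optAlpha n r A B) := by
  rw [negLog2]
  split_ifs with h0
  · exact le_top
  have hpos : 0 < 1 - optAlpha n r A B :=
    lt_of_le_of_ne (sub_nonneg.2 (optAlpha_le_one hA r B)) (Ne.symm h0)
  have hα' : 0 < (α - 1) / α := div_pos (sub_pos.2 hα) (by linarith)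
  rw [EReal.coe_le_coe_iff, ← le_div_iff₀' hα', sub_le_comm]
  refine le_csInf hne ?_
  rintro _ ⟨ρ, hρ, σ, hσ, hs, rfl⟩
  have h1 := logb_le_of_le_rpow_mul_rpow hpos (qSand_pos (hA ρ hρ) (hB σ hσ) hs hα)
    (by positivity) hα (one_sub_optAlpha_le hAc hBc hA hB hρ hσ hs r hα)
  rw [Real.logb_rpow two_pos (by norm_num), ← div_le_iff₀' hα'] at h1
  rw [neg_div]
  linarith

lemma exists_sandwiched_lt_of_DUmSet_lt {A B : Set (Mat d n)} (hA : ∀ ρ ∈ A, IsState ρ)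
    (hB : ∀ σ ∈ B, σ.PosSemidef) {R : ℝ} (h : DUmSet A B < (R : EReal)) :
    ∃ α, 1 < α ∧ ∃ x ∈ sandVals α A B, x < R := by
  simp only [DUmSet, iInf_lt_iff] at h
  obtain ⟨ρ, hρ, σ, hσ, h⟩ := h
  rw [DUm] at h
  split_ifs at h with hs
  · obtain ⟨K, hK⟩ := (exists_eq_mul_iff (hB σ hσ).1).2 hs
    rw [EReal.coe_lt_coe_iff, mlog_eq_cfc (hA ρ hρ).1.1, mlog_eq_cfc (hB σ hσ).1] at h
    obtain ⟨α, hα, hx⟩ := exists_sandwiched_lt (hA ρ hρ).1 (hA ρ hρ).2 (hB σ hσ) hK h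
    refine ⟨α, hα, _, ⟨ρ, hρ, σ, hσ, hs, rfl⟩, ?_⟩
    rwa [qSand_eq_sandQ (hA ρ hρ).1 (hB σ hσ)]
  · exact absurd h (by simp)

end StrongConverse

/-- (Strong converse part of the refined generalized quantum Stein's lemma.)
Under the structural assumptions, for any `r > D^∞(A‖B)` the type-I error converges to one
exponentially fast, at rate at least `sup_{α>1} ((α-1)/α)(r - D_{S,α}^∞(A‖B)) > 0`. -/
theorem refined_steins_strong_converse {d : ℕ} {r c : ℝ} (hc : 0 ≤ c)
    (A B : ∀ n : ℕ, Set (Mat d n))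
    (hAconv : ∀ n, Convex ℝ (A n)) (hAcomp : ∀ n, IsCompact (A n))
    (hAperm : ∀ n, PermInvariant (A n)) (hAstate : ∀ n, ∀ ρ ∈ A n, IsState ρ)
    (hBconv : ∀ n, Convex ℝ (B n)) (hBcomp : ∀ n, IsCompact (B n))
    (hBperm : ∀ n, PermInvariant (B n)) (hBpsd : ∀ n, ∀ σ ∈ B n, σ.PosSemidef)
    (hAstable : Stable A) (hBstable : Stable B)
    (hApolar : Stable (fun n => polar (A n))) (hBpolar : Stable (fun n => polar (B n)))
    (hDmax : ∀ n : ℕ, DmaxSet (A n) (B n) ≤ ((c * n : ℝ) : EReal))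
    (hrD : liminf (fun n : ℕ => (((n : ℝ)⁻¹ : ℝ) : EReal) * DUmSet (A n) (B n)) atTop <
      (r : EReal)) :
    ∃ DS : ℝ → EReal,
      (∀ α ∈ Set.Ioi (1 : ℝ),
        Tendsto (fun n : ℕ => (((n : ℝ)⁻¹ : ℝ) : EReal) * DSandSet α (A n) (B n))
          atTop (nhds (DS α))) ∧
      (⨆ α ∈ Set.Ioi (1 : ℝ), (((α - 1) / α : ℝ) : EReal) * ((r : EReal) - DS α)) ≤
        liminf
          (fun n : ℕ =>
            (((n : ℝ)⁻¹ : ℝ) : EReal) * negLog2 (1 - optAlpha n r (A n) (B n)))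
          atTop ∧
      (0 : EReal) <
        ⨆ α ∈ Set.Ioi (1 : ℝ), (((α - 1) / α : ℝ) : EReal) * ((r : EReal) - DS α) := by
  have hpsd : ∀ n, ∀ ρ ∈ A n, ρ.PosSemidef := fun n ρ hρ => (hAstate n ρ hρ).1
  obtain ⟨S, T, hS, hT, htr⟩ := exists_trace_le B hBcomp hBpolar
  have hne : ∀ (α : ℝ) (n : ℕ), (sandVals α (A n) (B n)).Nonempty := by
    intro α n
    obtain ⟨ρ, hρ, σ, hσ, hs⟩ := exists_suppLE_of_DmaxSet_lt_top (hpsd n)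
      ((hDmax n).trans_lt (EReal.coe_lt_top _))
    exact ⟨_, ρ, hρ, σ, hσ, hs, rfl⟩
  have hlb : ∀ α : ℝ, 1 < α → ∀ (n : ℕ), ∀ x ∈ sandVals α (A n) (B n),
      -Real.logb 2 (S * T ^ n) ≤ x := by
    rintro α hα n _ ⟨ρ, hρ, σ, hσ, hs, rfl⟩
    exact neg_logb_le_sandwiched (hAstate n ρ hρ) (hBpsd n σ hσ) hs (by positivity) (htr n σ hσ) hα
  have hbdd : ∀ α : ℝ, 1 < α → ∀ n : ℕ, BddBelow (sandVals α (A n) (B n)) :=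
    fun α hα n => ⟨_, hlb α hα n⟩
  have hlim : ∀ α : ℝ, ∃ L : ℝ, 1 < α →
      Tendsto (fun n : ℕ => sInf (sandVals α (A n) (B n)) / n) atTop (nhds L) ∧
        ∀ n : ℕ, n ≠ 0 → L ≤ sInf (sandVals α (A n) (B n)) / n := by
    intro α
    by_cases hα : 1 < α
    swap
    · exact ⟨0, fun h => absurd h hα⟩
    have hsub : Subadditive fun n : ℕ => sInf (sandVals α (A n) (B n)) := fun m n =>
      sInf_sandVals_add_le hα (hAstate m) (hAstate n) (hBpsd m) (hBpsd n) (hAstable m n)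
        (hBstable m n) (hne α m) (hne α n) (hbdd α hα (m + n))
    have hbd : BddBelow (Set.range fun n : ℕ => sInf (sandVals α (A n) (B n)) / n) := by
      refine ⟨-(|Real.logb 2 S| + |Real.logb 2 T|), ?_⟩
      rintro _ ⟨n, rfl⟩
      rcases n.eq_zero_or_pos with rfl | hn
      · simp only [Nat.cast_zero, div_zero]
        linarith [abs_nonneg (Real.logb 2 S), abs_nonneg (Real.logb 2 T)]
      · have hn1 : (1 : ℝ) ≤ n := by exact_mod_cast hn
        have h := le_csInf (hne α n) (hlb α hα n)
        rw [Real.logb_mul hS.ne' (by positivity), Real.logb_pow] at h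
        simp only
        rw [le_div_iff₀ (by linarith)]
        nlinarith [abs_nonneg (Real.logb 2 S), le_abs_self (Real.logb 2 S),
          le_abs_self (Real.logb 2 T)]
    exact ⟨hsub.lim, fun _ => ⟨hsub.tendsto_lim hbd, fun n hn => hsub.lim_le_div hbd hn⟩⟩
  choose L hL using hlim
  refine ⟨fun α => (L α : EReal), fun α hα => ?_, iSup₂_le fun α hα => ?_, ?_⟩
  · refine ((continuous_coe_real_ereal.tendsto _).comp (hL α hα).1).congr fun n => ?_
    rw [DSandSet_eq_coe_sInf (hne α n) (hbdd α hα n), ← EReal.coe_mul, inv_mul_eq_div]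
    rfl
  · have hα : 1 < α := hα
    have ht : Tendsto (fun n : ℕ =>
        (((α - 1) / α * (r - sInf (sandVals α (A n) (B n)) / n) : ℝ) : EReal)) atTop
        (nhds (((α - 1) / α * (r - L α) : ℝ) : EReal)) :=
      (continuous_coe_real_ereal.tendsto _).comp (((hL α hα).1.const_sub r).const_mul _)
    rw [← EReal.coe_sub, ← EReal.coe_mul, ← ht.liminf_eq]
    refine liminf_le_liminf ?_
    filter_upwards [eventually_ge_atTop 1] with n hn
    have hn0 : (0 : ℝ) < n := by exact_mod_cast hn
    have h := le_negLog2_one_sub_optAlpha (hAcomp n) (hBcomp n) (hAstate n) (hBpsd n) r hα (hne α n)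
    refine le_trans (le_of_eq ?_) (mul_le_mul_of_nonneg_left h
      (EReal.coe_nonneg.2 (inv_nonneg.2 hn0.le)))
    rw [← EReal.coe_mul, EReal.coe_eq_coe_iff]
    field_simp
  · obtain ⟨n, hn, hn1⟩ := ((frequently_lt_of_liminf_lt (by isBoundedDefault) hrD).and_eventually
      (eventually_ge_atTop 1)).exists
    have hn0 : (0 : ℝ) < n := by exact_mod_cast hn1
    have hlt : DUmSet (A n) (B n) < ((n * r : ℝ) : EReal) := by
      by_contra! hle
      refine hn.not_ge (le_trans (le_of_eq ?_) (mul_le_mul_of_nonneg_left hle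
        (EReal.coe_nonneg.2 (inv_nonneg.2 hn0.le))))
      rw [← EReal.coe_mul, inv_mul_cancel_left₀ hn0.ne']
    obtain ⟨α, hα, x, hx, hxr⟩ := exists_sandwiched_lt_of_DUmSet_lt (hAstate n) (hBpsd n) hlt
    have hLr : L α < r := by
      refine ((hL α hα).2 n (by omega)).trans_lt ?_
      rw [div_lt_iff₀ hn0, mul_comm]
      exact (csInf_le (hbdd α hα n) hx).trans_lt hxr
    refine lt_of_lt_of_le ?_ (le_iSup₂ (f := fun (α : ℝ) (_ : α ∈ Set.Ioi (1 : ℝ)) =>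
      (((α - 1) / α : ℝ) : EReal) * ((r : EReal) - (L α : EReal))) α hα)
    rw [← EReal.coe_sub, ← EReal.coe_mul, EReal.coe_pos]
    exact mul_pos (div_pos (sub_pos.2 hα) (by linarith)) (sub_pos.2 hLr)

end
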